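/- Let S be a non-exceptional semigroup of polynomials that is cancellative and contains no free subsemigroup of rank 2. Then S is amenable. -/

import Mathlib

/-- A real-valued function on `σ` is bounded. -/
def Bdd {σ : Type*} (f : σ → ℝ) : Prop := ∃ C : ℝ, ∀ s, |f s| ≤ C

/-- A mean on `σ`: a normalized positive real-linear functional on the space `ℓ∞(σ)`
of bounded real-valued functions on `σ`. -/
structure Mean (σ : Type*) where
  toFun : (σ → ℝ) → ℝ
  map_add' : ∀ f g : σ → ℝ, Bdd f → Bdd g → toFun (f + g) = toFun f + toFun g
  map_smul' : ∀ (c : ℝ) (f : σ → ℝ), Bdd f → toFun (c • f) = c * toFun f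
  nonneg' : ∀ f : σ → ℝ, Bdd f → (∀ s, 0 ≤ f s) → 0 ≤ toFun f
  one' : toFun (fun _ => (1 : ℝ)) = 1

/-- `M` is a left invariant mean on a set `S` of polynomials, regarded as a semigroup
with product `g·h := g ∘ h` (polynomial composition):  `M (g ↦ f (h ∘ g)) = M f`. -/
def PolyLeftInv (S : Set (Polynomial ℂ)) (M : Mean S) : Prop :=
  ∀ (h : S) (hc : ∀ g : S, (h : Polynomial ℂ).comp (g : Polynomial ℂ) ∈ S),
    ∀ f : S → ℝ, Bdd f →
      M.toFun (fun g : S => f ⟨(h : Polynomial ℂ).comp (g : Polynomial ℂ), hc g⟩) = M.toFun f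

/-- `M` is a right invariant mean on a set `S` of polynomials under composition:
`M (g ↦ f (g ∘ h)) = M f`. -/
def PolyRightInv (S : Set (Polynomial ℂ)) (M : Mean S) : Prop :=
  ∀ (h : S) (hc : ∀ g : S, (g : Polynomial ℂ).comp (h : Polynomial ℂ) ∈ S),
    ∀ f : S → ℝ, Bdd f →
      M.toFun (fun g : S => f ⟨(g : Polynomial ℂ).comp (h : Polynomial ℂ), hc g⟩) = M.toFun f

/-- The affine conjugate `σ ∘ P ∘ σ⁻¹` of `P` by `σ(z) = a z + b` (with
`σ⁻¹(z) = a⁻¹ (z - b)`), as a polynomial. -/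
noncomputable def affConj (a b : ℂ) (P : Polynomial ℂ) : Polynomial ℂ :=
  ((Polynomial.C a * Polynomial.X + Polynomial.C b).comp P).comp
    (Polynomial.C a⁻¹ * (Polynomial.X - Polynomial.C b))

/-- A polynomial is exceptional if it has degree at most one, or is affinely conjugate
to the power map `z ↦ z^{deg P}` or to `± T_{deg P}` where `T_n` is the degree-`n`
Chebyshev polynomial. -/
def IsExceptional (P : Polynomial ℂ) : Prop :=
  P.natDegree ≤ 1 ∨
  ∃ a b : ℂ, a ≠ 0 ∧
    (affConj a b P = Polynomial.X ^ P.natDegree ∨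
     affConj a b P = Polynomial.Chebyshev.T ℂ (P.natDegree : ℤ) ∨
     affConj a b P = -Polynomial.Chebyshev.T ℂ (P.natDegree : ℤ))

/-- `S` contains a free subsemigroup of rank `k` under composition: there are
`s 0, …, s (k-1) ∈ S` such that distinct nonempty words in the `s i` give distinct
polynomials (injectivity of the canonical homomorphism from the free semigroup on
`k` generators). -/
def PolyHasFreeSG (S : Set (Polynomial ℂ)) (k : ℕ) : Prop :=
  ∃ s : Fin k → Polynomial ℂ, (∀ i, s i ∈ S) ∧
    ∀ l m : List (Fin k), l ≠ [] → m ≠ [] →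
      (l.map s).foldr Polynomial.comp Polynomial.X =
        (m.map s).foldr Polynomial.comp Polynomial.X → l = m

/-- `S` is left cancellative for the product `g·h := g ∘ h`. -/
def PolyLeftCancellative (S : Set (Polynomial ℂ)) : Prop :=
  ∀ a ∈ S, ∀ b ∈ S, ∀ c ∈ S, a.comp b = a.comp c → b = c

/-- `S` is right cancellative for the product `g·h := g ∘ h`. -/
def PolyRightCancellative (S : Set (Polynomial ℂ)) : Prop :=
  ∀ a ∈ S, ∀ b ∈ S, ∀ c ∈ S, b.comp a = c.comp a → b = c

/-- `S` is cancellative: both left and right cancellative. -/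
def PolyCancellative (S : Set (Polynomial ℂ)) : Prop :=
  PolyLeftCancellative S ∧ PolyRightCancellative S

open Polynomial in
/-- Right cancellation by a nonconstant polynomial. -/
theorem comp_right_cancel_of_natDegree_pos {p q r : ℂ[X]} (hr : 0 < r.natDegree)
    (h : p.comp r = q.comp r) : p = q := by
  have h0 : (p - q).comp r = 0 := by rw [sub_comp, h, sub_self]
  rcases comp_eq_zero_iff.1 h0 with h1 | ⟨-, h1⟩
  · exact sub_eq_zero.1 h1
  · rw [h1, natDegree_C] at hr
    exact absurd hr (lt_irrefl 0)

open Polynomial in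
/-- If `A ∘ a = B ∘ b` with `deg a = deg b`, then `a` is an affine function of `b`. -/
theorem eq_affine_of_comp_eq_comp {A B a b : ℂ[X]} (hA : 0 < A.natDegree)
    (ha : 0 < a.natDegree) (hab : a.natDegree = b.natDegree) (h : A.comp a = B.comp b) :
    ∃ u v : ℂ, a = C u * b + C v := by
  have hAB : A.natDegree = B.natDegree := by
    have := congrArg natDegree h
    rw [natDegree_comp, natDegree_comp, hab] at this
    exact Nat.eq_of_mul_eq_mul_right (hab ▸ ha) this
  set N := A.natDegree with hN
  set d := a.natDegree with hd
  have ha0 : a.leadingCoeff ≠ 0 := by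
    rw [Ne, leadingCoeff_eq_zero]; rintro rfl; simp at hd; omega
  have hb0 : b.leadingCoeff ≠ 0 := by
    rw [Ne, leadingCoeff_eq_zero]; rintro rfl; simp at hab; omega
  have hA0 : A.leadingCoeff ≠ 0 := by
    rw [Ne, leadingCoeff_eq_zero]; rintro rfl; simp at hN; omega
  set u := a.leadingCoeff / b.leadingCoeff with hu
  have hu0 : u ≠ 0 := div_ne_zero ha0 hb0
  have hlc : A.leadingCoeff * u ^ N = B.leadingCoeff := by
    have := congrArg leadingCoeff h
    rw [leadingCoeff_comp (by omega), leadingCoeff_comp (by omega), ← hN, ← hAB] at this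
    rw [hu, div_pow]
    field_simp
    linear_combination this
  refine ⟨u, (a - C u * b).coeff 0, ?_⟩
  suffices hs : (a - C u * b).natDegree = 0 by
    rw [← eq_C_of_natDegree_eq_zero hs]; ring
  by_contra hne
  set D := a - C u * b with hD
  have hD0 : D ≠ 0 := by rintro h0; rw [h0] at hne; simp at hne
  set G := ∑ i ∈ Finset.range N, a ^ i * (C u * b) ^ (N - 1 - i) with hG
  have hfac : G * D = a ^ N - (C u * b) ^ N := Commute.geom_sum₂_mul (Commute.all _ _) N
  have hGcoeff : G.coeff (d * (N - 1)) = N * a.leadingCoeff ^ (N - 1) := by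
    rw [hG, finsetSum_coeff]
    have : ∀ i ∈ Finset.range N, (a ^ i * (C u * b) ^ (N - 1 - i)).coeff (d * (N - 1))
        = a.leadingCoeff ^ (N - 1) := by
      intro i hi
      have hi' := Finset.mem_range.1 hi
      have hub : (C u * b).leadingCoeff = a.leadingCoeff := by
        rw [leadingCoeff_mul, leadingCoeff_C, hu]; field_simp
      have hubd : (C u * b).natDegree = d := by rw [natDegree_C_mul hu0, ← hab]
      have hdeg : (a ^ i * (C u * b) ^ (N - 1 - i)).natDegree = d * (N - 1) := by
        have hb' : b ≠ 0 := leadingCoeff_ne_zero.1 hb0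
        rw [natDegree_mul (pow_ne_zero _ (leadingCoeff_ne_zero.1 ha0))
          (pow_ne_zero _ (mul_ne_zero (C_ne_zero.2 hu0) hb')), natDegree_pow, natDegree_pow, hubd,
          ← hd, ← add_mul, mul_comm]
        congr 1
        omega
      rw [← hdeg, coeff_natDegree, leadingCoeff_mul, leadingCoeff_pow, leadingCoeff_pow, hub,
        ← pow_add]
      congr 1
      omega
    rw [Finset.sum_congr rfl this]
    simp
  have hGc0 : G.coeff (d * (N - 1)) ≠ 0 := by
    rw [hGcoeff]
    exact mul_ne_zero (Nat.cast_ne_zero.2 hA.ne') (pow_ne_zero _ ha0)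
  have hGd : d * (N - 1) ≤ G.natDegree := le_natDegree_of_ne_zero hGc0
  have hG0 : G ≠ 0 := by rintro h0; rw [h0] at hGc0; simp at hGc0
  have hlow : ∀ (Q q : ℂ[X]), Q.natDegree = N → q.natDegree = d →
      (Q.eraseLead.comp q).natDegree ≤ d * (N - 1) := by
    intro Q q hQ hq
    rw [natDegree_comp, hq, mul_comm]
    exact Nat.mul_le_mul_left _ ((eraseLead_natDegree_le Q).trans (by omega))
  have hsplit : ∀ (Q q : ℂ[X]), Q.natDegree = N →
      Q.comp q = Q.eraseLead.comp q + C Q.leadingCoeff * q ^ N := by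
    intro Q q hQ
    conv_lhs => rw [← eraseLead_add_C_mul_X_pow Q]
    simp [hQ]
  have key : C A.leadingCoeff * (G * D) = B.eraseLead.comp b - A.eraseLead.comp a := by
    rw [hfac, mul_pow, ← C_pow, mul_sub, ← mul_assoc, ← C_mul, hlc]
    rw [hsplit A a rfl, hsplit B b hAB.symm] at h
    linear_combination h
  have h1 : (C A.leadingCoeff * (G * D)).natDegree ≤ d * (N - 1) := by
    rw [key]
    exact (natDegree_sub_le _ _).trans (max_le (hlow B b hAB.symm hab.symm) (hlow A a rfl rfl))
  rw [natDegree_C_mul hA0, natDegree_mul hG0 hD0] at h1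
  omega

open Polynomial in
theorem natDegree_foldr_comp {ι : Type*} (s : ι → ℂ[X]) (d : ℕ) (hs : ∀ i, (s i).natDegree = d)
    (l : List ι) : ((l.map s).foldr comp X).natDegree = d ^ l.length := by
  induction l with
  | nil => simp
  | cons i l ih => simp [natDegree_comp, ih, hs, pow_succ']

open Polynomial in
theorem foldr_comp_append_singleton {ι : Type*} (s : ι → ℂ[X]) (l : List ι) (i : ι) :
    ((l ++ [i]).map s).foldr comp X = ((l.map s).foldr comp X).comp (s i) := by
  induction l with
  | nil => simp
  | cons j l ih => simp at ih ⊢; rw [ih, comp_assoc]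

open Polynomial in
/-- Two distinct words with the same composite, in letters of the same degree, force two distinct
letters to be affinely related. -/
theorem exists_eq_affine_of_foldr_comp_eq {ι : Type*} (s : ι → ℂ[X]) (d : ℕ) (hd : 2 ≤ d)
    (hs : ∀ i, (s i).natDegree = d) (l m : List ι) (hlm : l ≠ m)
    (h : (l.map s).foldr comp X = (m.map s).foldr comp X) :
    ∃ i j, i ≠ j ∧ ∃ u v : ℂ, s i = C u * s j + C v := by
  induction l using List.reverseRecOn generalizing m with
  | nil =>
    have := congrArg natDegree h
    rw [natDegree_foldr_comp s d hs, natDegree_foldr_comp s d hs] at this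
    have h' := Nat.pow_right_injective hd this
    exact absurd (List.length_eq_zero_iff.1 h'.symm).symm hlm
  | append_singleton l i ih =>
    induction m using List.reverseRecOn with
    | nil =>
      have := congrArg natDegree h
      rw [natDegree_foldr_comp s d hs, natDegree_foldr_comp s d hs] at this
      have h' := Nat.pow_right_injective hd this
      simp at h'
    | append_singleton m j _ =>
      rw [foldr_comp_append_singleton, foldr_comp_append_singleton] at h
      by_cases hij : i = j
      · subst hij
        exact ih m (fun e => hlm (by rw [e]))
          (comp_right_cancel_of_natDegree_pos (by rw [hs]; omega) h)
      · refine ⟨i, j, hij, eq_affine_of_comp_eq_comp ?_ (by rw [hs]; omega)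
          (by rw [hs, hs]) h⟩
        rw [natDegree_foldr_comp s d hs]
        positivity

open Polynomial in
/-- In a set of polynomials without free subsemigroups of rank two, elements of the same degree
are affinely related. -/
theorem eq_affine_of_natDegree_eq {S : Set ℂ[X]} (hfree : ¬ PolyHasFreeSG S 2) {a b : ℂ[X]}
    (ha : a ∈ S) (hb : b ∈ S) (hdeg : 2 ≤ a.natDegree) (hab : a.natDegree = b.natDegree) :
    ∃ u v : ℂ, a = C u * b + C v := by
  unfold PolyHasFreeSG at hfree
  push Not at hfree
  obtain ⟨l, m, -, -, h, hlm⟩ := hfree ![a, b] (by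
    intro i; fin_cases i <;> simpa)
  obtain ⟨i, j, hij, u, v, huv⟩ := exists_eq_affine_of_foldr_comp_eq ![a, b] a.natDegree hdeg
    (by intro i; fin_cases i <;> simp [hab]) l m hlm h
  fin_cases i <;> fin_cases j
  · exact absurd rfl hij
  · exact ⟨u, v, huv⟩
  · simp only [Fin.mk_one, Fin.isValue, Matrix.cons_val_one, Matrix.cons_val_fin_one,
      Fin.zero_eta, Matrix.cons_val_zero] at huv
    have hu : u ≠ 0 := by
      rintro rfl
      rw [huv] at hab
      simp at hab
      omega
    refine ⟨u⁻¹, -(u⁻¹ * v), ?_⟩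
    have hC : C u⁻¹ * C u = (1 : ℂ[X]) := by rw [← C_mul, inv_mul_cancel₀ hu, C_1]
    rw [huv, C_neg, C_mul]
    linear_combination (-a) * hC
  · exact absurd rfl hij

open Polynomial in
/-- A polynomial of degree at least two whose derivative has `c` as its only root is of the form
`k (z - c) ^ n + v`. -/
theorem eq_pow_add_of_derivative_roots {P : ℂ[X]} {c : ℂ} (hP : 2 ≤ P.natDegree)
    (h : ∀ x ∈ P.derivative.roots, x = c) :
    ∃ k v : ℂ, k ≠ 0 ∧ P = C k * (X - C c) ^ P.natDegree + C v := by
  set n := P.natDegree with hn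
  have hP' : P.derivative ≠ 0 := by
    intro h0
    have := derivative_eq_zero.1 h0
    omega
  have hprod := (IsAlgClosed.splits P.derivative).eq_prod_roots
  have hcard : P.derivative.roots.card = n - 1 := by
    rw [← (IsAlgClosed.splits P.derivative).natDegree_eq_card_roots, natDegree_derivative]
  rw [Multiset.eq_replicate.2 ⟨hcard, h⟩] at hprod
  simp only [Multiset.map_replicate, Multiset.prod_replicate] at hprod
  have hn0 : (n : ℂ) ≠ 0 := Nat.cast_ne_zero.2 (by omega)
  set k := P.derivative.leadingCoeff / n with hk
  have hk0 : k ≠ 0 := div_ne_zero (leadingCoeff_ne_zero.2 hP') hn0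
  have hder : (P - C k * (X - C c) ^ n).derivative = 0 := by
    rw [derivative_sub, derivative_C_mul, derivative_X_sub_C_pow, hprod, ← mul_assoc,
      ← C_mul, hk, div_mul_cancel₀ _ hn0, sub_self]
  refine ⟨k, (P - C k * (X - C c) ^ n).coeff 0, hk0, ?_⟩
  rw [← eq_C_of_natDegree_eq_zero (derivative_eq_zero.1 hder)]
  ring

open Polynomial in
theorem isExceptional_of_eq_pow {P : ℂ[X]} {k c : ℂ} (hP : 2 ≤ P.natDegree) (hk : k ≠ 0)
    (h : P = C k * (X - C c) ^ P.natDegree + C c) : IsExceptional P := by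
  set n := P.natDegree
  obtain ⟨t, ht⟩ := IsAlgClosed.exists_pow_nat_eq k (show 0 < n - 1 by omega)
  have ht0 : t ≠ 0 := by
    rintro rfl
    rw [zero_pow (by omega)] at ht
    exact hk ht.symm
  refine Or.inr ⟨t, -(t * c), ht0, Or.inl ?_⟩
  have hC : C t⁻¹ * C t = (1 : ℂ[X]) := by rw [← C_mul, inv_mul_cancel₀ ht0, C_1]
  have hn : t * k = t ^ n := by
    rw [← ht, ← pow_succ', Nat.sub_add_cancel (by omega)]
  change affConj t (-(t * c)) P = X ^ n
  rw [h]
  unfold affConj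
  simp only [add_comp, mul_comp, sub_comp, pow_comp, X_comp, C_comp]
  have e1 : C t⁻¹ * (X - C (-(t * c))) - C c = C t⁻¹ * X := by
    rw [C_neg, C_mul]
    linear_combination (C c) * hC
  rw [e1, mul_add, ← mul_assoc, ← C_mul, hn, C_pow, mul_pow, ← mul_assoc, ← mul_pow,
    mul_comm (C t), hC, C_neg, C_mul]
  ring

open Polynomial in
/-- A polynomial which is not exceptional, or its second iterate, has two critical points. -/
theorem exists_two_critical_points {S : Set ℂ[X]} (hcomp : ∀ p ∈ S, ∀ q ∈ S, p.comp q ∈ S)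
    {P : ℂ[X]} (hPS : P ∈ S) (hP : ¬ IsExceptional P) :
    ∃ R ∈ S, ∃ x ∈ R.derivative.roots, ∃ y ∈ R.derivative.roots, x ≠ y := by
  have hdeg : 2 ≤ P.natDegree := by
    by_contra hlt
    exact hP (Or.inl (by omega))
  have hder_deg : P.derivative.natDegree = P.natDegree - 1 := natDegree_derivative P
  have hder_ne : P.derivative ≠ 0 := by
    intro h0
    rw [h0, natDegree_zero] at hder_deg
    omega
  obtain ⟨c, hc⟩ := IsAlgClosed.exists_root P.derivative (by
    rw [degree_eq_natDegree hder_ne, hder_deg]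
    exact_mod_cast (show P.natDegree - 1 ≠ 0 by omega))
  have hc' : c ∈ P.derivative.roots := (mem_roots hder_ne).2 hc
  by_cases hall : ∀ x ∈ P.derivative.roots, x = c
  · obtain ⟨k, v, hk, hPeq⟩ := eq_pow_add_of_derivative_roots hdeg hall
    have hvc : v ≠ c := by
      rintro rfl
      exact hP (isExceptional_of_eq_pow hdeg hk hPeq)
    obtain ⟨w, hw⟩ := IsAlgClosed.exists_root (P - C c) (by
      rw [degree_sub_C (natDegree_pos_iff_degree_pos.1 (by omega)),
        degree_eq_natDegree (by rintro rfl; simp at hdeg)]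
      exact_mod_cast (show P.natDegree ≠ 0 by omega))
    have hwc : P.eval w = c := by
      simpa [sub_eq_zero] using hw
    have hwne : w ≠ c := by
      rintro rfl
      rw [hPeq] at hwc
      simp only [eval_add, eval_mul, eval_C, eval_pow, eval_sub, eval_X, sub_self] at hwc
      rw [zero_pow (by omega), mul_zero, zero_add] at hwc
      exact hvc hwc
    have h0 : (P.comp P).derivative ≠ 0 := by
      intro h0
      have := derivative_eq_zero.1 h0
      rw [natDegree_comp] at this
      have : 0 < P.natDegree * P.natDegree := Nat.mul_pos (by omega) (by omega)
      omega
    refine ⟨P.comp P, hcomp P hPS P hPS, c, (mem_roots h0).2 ?_, w, (mem_roots h0).2 ?_, hwne.symm⟩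
    · rw [IsRoot.def, derivative_comp, eval_mul, hc.eq_zero, zero_mul]
    · rw [IsRoot.def, derivative_comp, eval_mul, eval_comp, hwc, hc.eq_zero, mul_zero]
  · push Not at hall
    obtain ⟨x, hx, hxc⟩ := hall
    exact ⟨P, hPS, x, hx, c, hc', hxc⟩

open Polynomial in
/-- A family of affinely related polynomials that stays affinely related after composition with a
polynomial `R` having two critical points is finite, with a bound depending only on `R`. -/
theorem finite_and_ncard_le_of_affine {A : Set ℂ[X]} {R : ℂ[X]} {x y : ℂ}
    (hx : x ∈ R.derivative.roots) (hy : y ∈ R.derivative.roots) (hxy : x ≠ y)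
    (hpos : ∀ a ∈ A, 0 < a.natDegree)
    (hA : ∀ a ∈ A, ∀ b ∈ A, ∃ u v : ℂ, a = C u * b + C v)
    (hR : ∀ a ∈ A, ∀ b ∈ A, ∃ u v : ℂ, R.comp a = C u * R.comp b + C v) :
    A.Finite ∧ A.ncard ≤ (R.derivative.roots.toFinset ×ˢ R.derivative.roots.toFinset).card := by
  classical
  rcases A.eq_empty_or_nonempty with rfl | ⟨b, hb⟩
  · simp
  choose! u v huv using fun a (ha : a ∈ A) => hA a ha b hb
  have hroot : ∀ a ∈ A, ∀ r ∈ R.derivative.roots, u a * r + v a ∈ R.derivative.roots := by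
    intro a ha r hr
    have hR0 : R.derivative ≠ 0 := ne_zero_of_mem_roots hr
    obtain ⟨u', v', h'⟩ := hR a ha b hb
    have hua : u a ≠ 0 := by
      intro h0
      have h1 := hpos a ha
      rw [huv a ha, h0] at h1
      simp at h1
    have e : R.comp (C (u a) * X + C (v a)) = C u' * R + C v' := by
      refine comp_right_cancel_of_natDegree_pos (hpos b hb) ?_
      rw [comp_assoc]
      simp only [add_comp, mul_comp, C_comp, X_comp]
      rw [← huv a ha, h']
    have e' := congrArg (fun p => (derivative p).eval r) e
    have hr' : R.derivative.eval r = 0 := (mem_roots hR0).1 hr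
    simp only [derivative_comp, derivative_add, derivative_mul, derivative_C, derivative_X,
      eval_mul, eval_comp, eval_add, eval_C, eval_X, hr', eval_zero, eval_one] at e'
    rw [mem_roots hR0, IsRoot.def]
    simpa [hua] using e'
  let F : ℂ[X] → ℂ × ℂ := fun a => (u a * x + v a, u a * y + v a)
  have hmaps : ∀ a ∈ A, F a ∈
      ((R.derivative.roots.toFinset ×ˢ R.derivative.roots.toFinset : Finset (ℂ × ℂ)) :
        Set (ℂ × ℂ)) := by
    intro a ha
    simp only [Finset.coe_product, Set.mem_prod, Finset.mem_coe, Multiset.mem_toFinset]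
    exact ⟨hroot a ha x hx, hroot a ha y hy⟩
  have hinj : Set.InjOn F A := by
    intro a ha a' ha' hF
    obtain ⟨h1, h2⟩ := Prod.mk.inj hF
    have h3 : (u a - u a') * (x - y) = 0 := by linear_combination h1 - h2
    have h4 : u a = u a' :=
      sub_eq_zero.1 ((mul_eq_zero.1 h3).resolve_right (sub_ne_zero.2 hxy))
    have h5 : v a = v a' := by
      rw [h4] at h1
      exact add_left_cancel h1
    rw [huv a ha, huv a' ha', h4, h5]
  refine ⟨Set.Finite.of_injOn hmaps hinj (Finset.finite_toSet _), ?_⟩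
  rw [← Set.ncard_coe_finset]
  exact Set.ncard_le_ncard_of_injOn F hmaps hinj (Finset.finite_toSet _)

open Polynomial in
/-- The elements of given degree in a non-exceptional semigroup of polynomials without free
subsemigroups of rank two are finite in number, uniformly in the degree. -/
theorem exists_forall_finite_and_ncard_le (S : Set ℂ[X])
    (hdeg : ∀ p ∈ S, 0 < p.natDegree)
    (hcomp : ∀ p ∈ S, ∀ q ∈ S, p.comp q ∈ S)
    (hexc : ∃ P ∈ S, ¬ IsExceptional P)
    (hfree : ¬ PolyHasFreeSG S 2) :
    ∃ K : ℕ, ∀ n, {p | p ∈ S ∧ p.natDegree = n}.Finite ∧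
      {p | p ∈ S ∧ p.natDegree = n}.ncard ≤ K := by
  obtain ⟨P, hPS, hP⟩ := hexc
  have hPdeg : 2 ≤ P.natDegree := by
    by_contra hlt
    exact hP (Or.inl (by omega))
  obtain ⟨R, hRS, x, hx, y, hy, hxy⟩ := exists_two_critical_points hcomp hPS hP
  have main : ∀ n, 2 ≤ n → {p | p ∈ S ∧ p.natDegree = n}.Finite ∧
      {p | p ∈ S ∧ p.natDegree = n}.ncard ≤
        (R.derivative.roots.toFinset ×ˢ R.derivative.roots.toFinset).card := by
    intro n hn
    refine finite_and_ncard_le_of_affine hx hy hxy (fun a ha => hdeg a ha.1) ?_ ?_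
    · rintro a ⟨ha, han⟩ b ⟨hb, hbn⟩
      exact eq_affine_of_natDegree_eq hfree ha hb (by omega) (by omega)
    · rintro a ⟨ha, han⟩ b ⟨hb, hbn⟩
      refine eq_affine_of_natDegree_eq hfree (hcomp R hRS a ha) (hcomp R hRS b hb) ?_ ?_
      · rw [natDegree_comp, han]
        exact hn.trans (Nat.le_mul_of_pos_left n (hdeg R hRS))
      · rw [natDegree_comp, natDegree_comp, han, hbn]
  refine ⟨(R.derivative.roots.toFinset ×ˢ R.derivative.roots.toFinset).card, fun n => ?_⟩
  rcases le_or_gt 2 n with hn | hn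
  · exact main n hn
  · rcases Nat.eq_zero_or_pos n with rfl | hn0
    · have : {p | p ∈ S ∧ p.natDegree = 0} = ∅ := by
        ext p
        simp only [Set.mem_ofPred_eq, Set.mem_empty_iff_false, iff_false, not_and]
        exact fun hp => (hdeg p hp).ne'
      rw [this]
      simp
    · obtain rfl : n = 1 := by omega
      obtain ⟨hfin, hcard⟩ := main P.natDegree hPdeg
      have hmaps : ∀ p ∈ {p | p ∈ S ∧ p.natDegree = 1},
          p.comp P ∈ {p | p ∈ S ∧ p.natDegree = P.natDegree} := by
        rintro p ⟨hp, hp1⟩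
        exact ⟨hcomp p hp P hPS, by rw [natDegree_comp, hp1, one_mul]⟩
      have hinj : Set.InjOn (fun p : ℂ[X] => p.comp P) {p | p ∈ S ∧ p.natDegree = 1} :=
        fun p _ q _ h => comp_right_cancel_of_natDegree_pos (hdeg P hPS) h
      exact ⟨Set.Finite.of_injOn hmaps hinj hfin,
        (Set.ncard_le_ncard_of_injOn _ hmaps hinj hfin).trans hcard⟩

namespace Bdd

variable {σ : Type*} {f g : σ → ℝ}

theorem add (hf : Bdd f) (hg : Bdd g) : Bdd (f + g) := by
  obtain ⟨C, hC⟩ := hf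
  obtain ⟨D, hD⟩ := hg
  exact ⟨C + D, fun s => (abs_add_le _ _).trans (add_le_add (hC s) (hD s))⟩

theorem smul (c : ℝ) (hf : Bdd f) : Bdd (c • f) := by
  obtain ⟨C, hC⟩ := hf
  refine ⟨|c| * C, fun s => ?_⟩
  rw [Pi.smul_apply, smul_eq_mul, abs_mul]
  exact mul_le_mul_of_nonneg_left (hC s) (abs_nonneg c)

theorem const (c : ℝ) : Bdd (fun _ : σ => c) := ⟨|c|, fun _ => le_rfl⟩

theorem comp {τ : Type*} (hf : Bdd f) (k : τ → σ) : Bdd (fun t => f (k t)) := by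
  obtain ⟨C, hC⟩ := hf
  exact ⟨C, fun t => hC _⟩

end Bdd

namespace Mean

variable {σ τ ι : Type*}

theorem map_const (M : Mean σ) (c : ℝ) : M.toFun (fun _ => c) = c := by
  have h := M.map_smul' c (fun _ => 1) (Bdd.const 1)
  rw [M.one', mul_one] at h
  exact (congrArg M.toFun (funext fun _ => (mul_one c).symm)).trans h

theorem map_le_of_le (M : Mean σ) {f : σ → ℝ} (hf : Bdd f) {C : ℝ} (hC : ∀ s, f s ≤ C) :
    M.toFun f ≤ C := by
  have h1 := M.nonneg' ((fun _ => C) + (-1 : ℝ) • f) ((Bdd.const C).add (hf.smul _))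
    (fun s => by have := hC s; simp only [Pi.add_apply, Pi.smul_apply, smul_eq_mul]; linarith)
  rw [M.map_add' _ _ (Bdd.const C) (hf.smul _), M.map_smul' _ _ hf, M.map_const] at h1
  linarith

theorem abs_map_le (M : Mean σ) {f : σ → ℝ} {C : ℝ} (hC : ∀ s, |f s| ≤ C) :
    |M.toFun f| ≤ C := by
  have hf : Bdd f := ⟨C, hC⟩
  have h1 := M.map_le_of_le hf (fun s => (le_abs_self _).trans (hC s))
  have h2 := M.map_le_of_le (hf.smul (-1)) (C := C)
    (fun s => by
      have := (neg_abs_le (f s)); have := hC s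
      simp only [Pi.smul_apply, smul_eq_mul]; linarith)
  rw [M.map_smul' _ _ hf] at h2
  exact abs_le.2 ⟨by linarith, h1⟩

/-- Evaluation at a point. -/
def dirac (s : σ) : Mean σ where
  toFun f := f s
  map_add' _ _ _ _ := rfl
  map_smul' _ _ _ := rfl
  nonneg' _ _ h := h s
  one' := rfl

open Finset in
/-- Averages of a mean on `τ` over a nonempty finite family of points of `σ` parametrized
by `τ`. -/
noncomputable def average (M : Mean τ) (A : Finset ι) (hA : A.Nonempty) (k : ι → τ → σ) :
    Mean σ where
  toFun f := (∑ i ∈ A, M.toFun (fun t => f (k i t))) / A.card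
  map_add' f g hf hg := by
    rw [← add_div, ← sum_add_distrib]
    congr 1
    exact sum_congr rfl fun i _ => M.map_add' _ _ (hf.comp (k i)) (hg.comp (k i))
  map_smul' c f hf := by
    rw [← mul_div_assoc, mul_sum]
    congr 1
    exact sum_congr rfl fun i _ => M.map_smul' _ _ (hf.comp (k i))
  nonneg' f hf h0 :=
    div_nonneg (sum_nonneg fun i _ => M.nonneg' _ (hf.comp (k i)) fun t => h0 _) (Nat.cast_nonneg _)
  one' := by
    simp only [M.one', sum_const, nsmul_eq_mul, mul_one]
    exact div_self (Nat.cast_ne_zero.2 hA.card_pos.ne')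

open Filter Topology in
/-- Limits of means along an ultrafilter exist. -/
theorem exists_tendsto (U : Ultrafilter ι) (m : ι → Mean σ) :
    ∃ M : Mean σ, ∀ f, Bdd f → Tendsto (fun i => (m i).toFun f) U (𝓝 (M.toFun f)) := by
  have hlim : ∀ f : σ → ℝ, Bdd f → ∃ x, Tendsto (fun i => (m i).toFun f) U (𝓝 x) := by
    rintro f ⟨C, hC⟩
    obtain ⟨x, -, hx⟩ := (isCompact_Icc (a := -C) (b := C)).ultrafilter_le_nhds
      (U.map fun i => (m i).toFun f)
      (by
        rw [le_principal_iff, Ultrafilter.mem_coe, Ultrafilter.mem_map]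
        exact Filter.univ_mem' fun i => abs_le.1 ((m i).abs_map_le hC))
    exact ⟨x, hx⟩
  choose! L hL using hlim
  refine ⟨⟨L, ?_, ?_, ?_, ?_⟩, hL⟩
  · intro f g hf hg
    refine tendsto_nhds_unique (hL _ (hf.add hg)) ?_
    simp only [fun i => (m i).map_add' f g hf hg]
    exact (hL f hf).add (hL g hg)
  · intro c f hf
    refine tendsto_nhds_unique (hL _ (hf.smul c)) ?_
    simp only [fun i => (m i).map_smul' c f hf]
    exact (hL f hf).const_mul c
  · intro f hf h0
    exact ge_of_tendsto' (hL f hf) fun i => (m i).nonneg' f hf h0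
  · refine tendsto_nhds_unique (hL _ (Bdd.const 1)) ?_
    simp only [fun i => (m i).one']
    exact tendsto_const_nhds

open Filter Topology in
/-- A mean on a commutative monoid invariant under some translations can be replaced by one which
is moreover invariant under a further translation. -/
theorem exists_invariant_insert {T : Type*} [CommMonoid T] (m : Mean T) (F : Set T)
    (hm : ∀ h ∈ F, ∀ f, Bdd f → m.toFun (fun t => f (h * t)) = m.toFun f) (a : T) :
    ∃ M : Mean T, ∀ h ∈ insert a F, ∀ f, Bdd f → M.toFun (fun t => f (h * t)) = M.toFun f := by
  let c : ℕ → Mean T := fun n =>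
    m.average (Finset.range (n + 1)) Finset.nonempty_range_add_one (fun e t => a ^ e * t)
  obtain ⟨M, hM⟩ := exists_tendsto (hyperfilter ℕ) c
  refine ⟨M, ?_⟩
  rintro h hh f hf
  have hfh : Bdd (fun t => f (h * t)) := hf.comp _
  refine tendsto_nhds_unique (hM _ hfh) ?_
  rcases hh with rfl | hh
  · obtain ⟨C, hC⟩ := hf
    have hdiff : Tendsto (fun n => (c n).toFun (fun t => f (h * t)) - (c n).toFun f)
        (hyperfilter ℕ) (𝓝 0) := by
      refine Tendsto.mono_left ?_ Nat.hyperfilter_le_atTop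
      have hz : Tendsto (fun n : ℕ => 2 * C * (1 / ((n : ℝ) + 1))) atTop (𝓝 0) := by
        simpa using tendsto_one_div_add_atTop_nhds_zero_nat.const_mul (2 * C)
      refine squeeze_zero_norm (fun n => ?_) hz
      have e1 : (c n).toFun (fun t => f (h * t)) - (c n).toFun f =
          (m.toFun (fun t => f (h ^ (n + 1) * t)) - m.toFun (fun t => f (h ^ 0 * t)))
            * (1 / ((n : ℝ) + 1)) := by
        change (∑ i ∈ Finset.range (n + 1), m.toFun (fun t => f (h * (h ^ i * t)))) / _ -
          (∑ i ∈ Finset.range (n + 1), m.toFun (fun t => f (h ^ i * t))) / _ = _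
        rw [← sub_div, ← Finset.sum_sub_distrib, Finset.card_range, Nat.cast_succ,
          div_eq_mul_one_div]
        congr 1
        rw [← Finset.sum_range_sub (fun i => m.toFun (fun t => f (h ^ i * t)))]
        refine Finset.sum_congr rfl fun i _ => ?_
        simp only [pow_succ', mul_assoc]
      rw [e1, Real.norm_eq_abs, abs_mul, abs_of_nonneg (by positivity : 0 ≤ 1 / ((n : ℝ) + 1))]
      refine mul_le_mul_of_nonneg_right ?_ (by positivity)
      refine (abs_sub _ _).trans ?_
      have b1 := m.abs_map_le (f := fun t => f (h ^ (n + 1) * t)) (fun t => hC _)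
      have b2 := m.abs_map_le (f := fun t => f (h ^ 0 * t)) (fun t => hC _)
      linarith
    simpa using hdiff.add (hM f ⟨C, hC⟩)
  · refine (hM f hf).congr fun n => ?_
    change (∑ i ∈ Finset.range (n + 1), m.toFun (fun t => f (a ^ i * t))) / _ =
      (∑ i ∈ Finset.range (n + 1), m.toFun (fun t => f (h * (a ^ i * t)))) / _
    congr 1
    refine Finset.sum_congr rfl fun i _ => ?_
    rw [← hm h hh _ (hf.comp fun t => a ^ i * t)]
    simp only [mul_left_comm]

open Filter Topology in
/-- Commutative monoids are amenable. -/
theorem exists_invariant (T : Type*) [CommMonoid T] :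
    ∃ M : Mean T, ∀ h f, Bdd f → M.toFun (fun t => f (h * t)) = M.toFun f := by
  classical
  have hfin : ∀ F : Finset T, ∃ m : Mean T,
      ∀ h ∈ (F : Set T), ∀ f, Bdd f → m.toFun (fun t => f (h * t)) = m.toFun f := by
    intro F
    induction F using Finset.induction_on with
    | empty => exact ⟨dirac 1, by simp⟩
    | insert a F _ ih =>
      obtain ⟨m, hm⟩ := ih
      rw [Finset.coe_insert]
      exact exists_invariant_insert m F hm a
  choose m hm using hfin
  obtain ⟨M, hM⟩ := exists_tendsto (Ultrafilter.of (atTop : Filter (Finset T))) m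
  refine ⟨M, fun h f hf => tendsto_nhds_unique (hM _ (hf.comp _)) ((hM f hf).congr' ?_)⟩
  filter_upwards [Ultrafilter.of_le (atTop : Filter (Finset T)) (eventually_ge_atTop {h})]
    with F hF
  exact (hm F h (Finset.singleton_subset_iff.1 hF) f hf).symm

/-- Push a mean on `σ` forward along a family of finite subsets of constant cardinality. -/
theorem exists_eq_average (m : Mean τ) (A : τ → Finset σ) (N : ℕ) (hN : 0 < N)
    (hA : ∀ t, (A t).card = N) :
    ∃ M : Mean σ, ∀ f, Bdd f → M.toFun f = m.toFun (fun t => (∑ s ∈ A t, f s) / N) := by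
  have hN' : (N : ℝ) ≠ 0 := Nat.cast_ne_zero.2 hN.ne'
  let e : ∀ t, Fin N ≃ A t := fun t => (Fintype.equivFinOfCardEq (by simp [hA t])).symm
  have : Nonempty (Fin N) := ⟨⟨0, hN⟩⟩
  refine ⟨m.average Finset.univ Finset.univ_nonempty (fun (i : Fin N) t => (e t i : σ)), ?_⟩
  intro f hf
  have hsum : ∀ B : Finset (Fin N), m.toFun (fun t => ∑ i ∈ B, f (e t i)) =
      ∑ i ∈ B, m.toFun (fun t => f (e t i)) ∧ Bdd (fun t => ∑ i ∈ B, f (e t i)) := by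
    intro B
    classical
    induction B using Finset.induction_on with
    | empty => simpa using ⟨m.map_const 0, Bdd.const 0⟩
    | insert i B hi ih =>
      simp only [Finset.sum_insert hi]
      have hb := hf.comp fun t => (e t i : σ)
      refine ⟨?_, hb.add ih.2⟩
      rw [← ih.1]
      exact m.map_add' _ _ hb ih.2
  have hconv : (fun t => (∑ s ∈ A t, f s) / (N : ℝ)) =
      (N : ℝ)⁻¹ • fun t => ∑ i : Fin N, f (e t i) := by
    funext t
    rw [Pi.smul_apply, smul_eq_mul, div_eq_inv_mul, ← Finset.sum_coe_sort (A t),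
      ← (e t).sum_comp]
  rw [hconv, m.map_smul' _ _ (hsum _).2, (hsum _).1]
  change _ / _ = _
  rw [Finset.card_univ, Fintype.card_fin, div_eq_inv_mul]

end Mean

/-- A non-exceptional cancellative semigroup of (nonconstant complex) polynomials
without free subsemigroups of rank 2 is amenable. -/
theorem cancellative_no_free_amenable
    (S : Set (Polynomial ℂ)) (hne : S.Nonempty)
    (hdeg : ∀ p ∈ S, 0 < p.natDegree)
    (hcomp : ∀ p ∈ S, ∀ q ∈ S, p.comp q ∈ S)
    (hexc : ∃ P ∈ S, ¬ IsExceptional P)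
    (hcanc : PolyCancellative S)
    (hfree : ¬ PolyHasFreeSG S 2) :
    ∃ M : Mean S, PolyLeftInv S M ∧ PolyRightInv S M := by
  classical
  obtain ⟨K, hK⟩ := exists_forall_finite_and_ncard_le S hdeg hcomp hexc hfree
  let L : ℕ → Set (Polynomial ℂ) := fun n => {p | p ∈ S ∧ p.natDegree = n}
  let V : Set ℕ := {k | ∃ s ∈ S, k = (L s.natDegree).ncard}
  have hVne : V.Nonempty := hne.imp' (fun s => (L s.natDegree).ncard) fun s hs => ⟨s, hs, rfl⟩
  have hVbdd : BddAbove V := ⟨K, by rintro k ⟨s, -, rfl⟩; exact (hK _).2⟩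
  obtain ⟨s₀, hs₀, hmax⟩ := Nat.sSup_mem hVne hVbdd
  set N := sSup V with hN
  have hle : ∀ s ∈ S, (L s.natDegree).ncard ≤ N := fun s hs => le_csSup hVbdd ⟨s, hs, rfl⟩
  have hNpos : 0 < N := by
    rw [hmax]
    exact (Set.ncard_pos (hK _).1).2 ⟨s₀, hs₀, rfl⟩
  let T : Submonoid ℕ :=
    { carrier := {t | t = 1 ∨ ∃ s ∈ S, s.natDegree = t}
      one_mem' := Or.inl rfl
      mul_mem' := by
        rintro a b (rfl | ⟨p, hp, rfl⟩) (rfl | ⟨q, hq, rfl⟩)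
        · exact Or.inl rfl
        · exact Or.inr ⟨q, hq, (one_mul _).symm⟩
        · exact Or.inr ⟨p, hp, (mul_one _).symm⟩
        · exact Or.inr ⟨p.comp q, hcomp p hp q hq, Polynomial.natDegree_comp⟩ }
  have hLmax : ∀ t : T, (L (s₀.natDegree * t)).ncard = N := by
    rintro ⟨t, rfl | ⟨s, hs, rfl⟩⟩
    · rw [mul_one, ← hmax]
    · refine le_antisymm ?_ ?_
      · have := hle _ (hcomp s₀ hs₀ s hs)
        rwa [Polynomial.natDegree_comp] at this
      · rw [hmax]
        refine Set.ncard_le_ncard_of_injOn (fun p : Polynomial ℂ => p.comp s) ?_ ?_ (hK _).1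
        · rintro p ⟨hp, hpd⟩
          exact ⟨hcomp p hp s hs, by rw [Polynomial.natDegree_comp, hpd]⟩
        · rintro p ⟨hp, -⟩ q ⟨hq, -⟩ h
          exact hcanc.2 s hs p hp q hq h
  have hfinS : ∀ n, {p : S | (p : Polynomial ℂ).natDegree = n}.Finite := fun n =>
    Set.Finite.of_injOn (t := L n) (f := Subtype.val) (fun p hp => ⟨p.2, hp⟩)
      Subtype.val_injective.injOn (hK n).1
  let A : T → Finset S := fun t => (hfinS (s₀.natDegree * t)).toFinset
  have hmemA : ∀ t p, p ∈ A t ↔ (p : Polynomial ℂ).natDegree = s₀.natDegree * t := by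
    intro t p
    simp [A]
  have hcardA : ∀ t, (A t).card = N := by
    intro t
    rw [← hLmax t, ← Set.ncard_coe_finset, ← Set.ncard_image_of_injective _ Subtype.val_injective]
    congr 1
    ext p
    constructor
    · rintro ⟨q, hq, rfl⟩
      exact ⟨q.2, (hmemA t q).1 hq⟩
    · rintro ⟨hp, hpd⟩
      exact ⟨⟨p, hp⟩, (hmemA t _).2 hpd, rfl⟩
  obtain ⟨m, hm⟩ := Mean.exists_invariant T
  obtain ⟨M, hM⟩ := m.exists_eq_average A N hNpos hcardA
  let δ : S → T := fun h => ⟨(h : Polynomial ℂ).natDegree, Or.inr ⟨h, h.2, rfl⟩⟩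
  have hinv : ∀ (h : S) (k : S → S), Function.Injective k →
      (∀ g, (k g : Polynomial ℂ).natDegree =
        (h : Polynomial ℂ).natDegree * (g : Polynomial ℂ).natDegree) →
      ∀ f : S → ℝ, Bdd f → M.toFun (fun g => f (k g)) = M.toFun f := by
    intro h k hk hkd f hf
    have himage : ∀ t, (A t).image k = A (δ h * t) := by
      intro t
      refine Finset.eq_of_subset_of_card_le ?_ ?_
      · intro q hq
        obtain ⟨p, hp, rfl⟩ := Finset.mem_image.1 hq
        rw [hmemA, hkd, (hmemA t p).1 hp]
        exact mul_left_comm _ _ _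
      · rw [Finset.card_image_of_injective _ hk, hcardA, hcardA]
    have hbdd : Bdd (fun t => (∑ s ∈ A t, f s) / (N : ℝ)) := by
      obtain ⟨C, hC⟩ := hf
      refine ⟨C, fun t => ?_⟩
      have hN' : (0 : ℝ) < N := Nat.cast_pos.2 hNpos
      rw [abs_div, abs_of_pos hN', div_le_iff₀ hN', mul_comm]
      refine (Finset.abs_sum_le_sum_abs _ _).trans ?_
      rw [← hcardA t, ← nsmul_eq_mul]
      exact Finset.sum_le_card_nsmul _ _ _ fun s _ => hC s
    rw [hM f hf, hM _ (hf.comp k), ← hm (δ h) _ hbdd]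
    congr 1
    funext t
    rw [← himage, Finset.sum_image hk.injOn]
  refine ⟨M, fun h hc f hf => ?_, fun h hc f hf => ?_⟩
  · refine hinv h (fun g => ⟨_, hc g⟩) ?_ (fun g => Polynomial.natDegree_comp) f hf
    intro p q hpq
    exact Subtype.ext (hcanc.1 h h.2 p p.2 q q.2 (congrArg Subtype.val hpq))
  · refine hinv h (fun g => ⟨_, hc g⟩) ?_
      (fun g => Polynomial.natDegree_comp.trans (mul_comm _ _)) f hf
    intro p q hpq
    exact Subtype.ext (hcanc.2 h h.2 p p.2 q q.2 (congrArg Subtype.val hpq))
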